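/- arXiv:1709.08888 — 3 statements merged into one kernel-verified Lean document; each statement's English description precedes it below -/
import Mathlib

section
/- Let ε_j be an infinitesimal sequence of positive numbers and let u_{ε_j} ∈ W^{1,∞}(Ω;[−1,1]) be Q-minima in Ω of the rescaled functionals 𝓔^{ε}_Ω(v) = (1/ε)∫_Ω E(x, v(x), ε∇v(x)) dx, satisfying sup_j ε_j ‖∇u_{ε_j}‖_{L^∞(Ω)} < +∞ and sup_j 𝓔^{ε_j}_Ω(u_{ε_j}) < +∞. Then there exists a measurable set E ⊆ Ω such that, up to a subsequence, u_{ε_j} converges to χ_E − χ_{ℝⁿ∖E} in L¹_loc(Ω). -/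
open MeasureTheory Filter
open scoped ENNReal Topology

/-- `u` is a `Q`-minimum in `Ω` of the energy functional with density `En`. -/
def IsQMinimum (n : ℕ)
    (En : EuclideanSpace ℝ (Fin n) → ℝ → EuclideanSpace ℝ (Fin n) → ℝ)
    (Q : ℝ) (Ω : Set (EuclideanSpace ℝ (Fin n)))
    (u : EuclideanSpace ℝ (Fin n) → ℝ) : Prop :=
  ∀ Ω' : Set (EuclideanSpace ℝ (Fin n)),
    IsOpen Ω' → Bornology.IsBounded Ω' → closure Ω' ⊆ Ω →
    IntegrableOn (fun x => En x (u x) (gradient u x)) Ω' volume ∧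
    ∀ v : EuclideanSpace ℝ (Fin n) → ℝ, (∃ K, LipschitzWith K v) →
      (∀ x ∉ Ω', v x = u x) →
      (∫ x in Ω', En x (u x) (gradient u x)) ≤ Q * ∫ x in Ω', En x (v x) (gradient v x)

attribute [local instance] Classical.propDecidable

open scoped NNReal

section TranslationCompactness

variable {E : Type*} [NormedAddCommGroup E] [NormedSpace ℝ E]

/-- A Lipschitz function is the integral of its derivative along a segment, provided it is
differentiable at almost every point of the segment. -/
theorem LipschitzWith.enorm_add_sub_le_lintegral_fderiv {C : ℝ≥0} {v : E → ℝ}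
    (hv : LipschitzWith C v) {x h : E}
    (hd : ∀ᵐ t : ℝ ∂volume.restrict (Set.Ioc 0 1), DifferentiableAt ℝ v (x + t • h)) :
    ‖v (x + h) - v x‖ₑ ≤ ∫⁻ t in Set.Ioc (0 : ℝ) 1, ‖fderiv ℝ v (x + t • h)‖ₑ * ‖h‖ₑ := by
  have hline : LipschitzWith ‖h‖₊ (fun t : ℝ => x + t • h) := by
    refine LipschitzWith.of_dist_le_mul fun s t => ?_
    rw [dist_add_left, dist_eq_norm, ← sub_smul, norm_smul, Real.dist_eq, mul_comm]
    simp
  have hac : AbsolutelyContinuousOnInterval (fun t : ℝ => v (x + t • h)) 0 1 :=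
    ((hv.comp hline).lipschitzOnWith (s := Set.uIcc 0 1)).absolutelyContinuousOnInterval
  have hftc := hac.integral_deriv_eq_sub
  rw [zero_smul, one_smul, add_zero] at hftc
  rw [← hftc, intervalIntegral.integral_of_le zero_le_one]
  refine (enorm_integral_le_lintegral_enorm _).trans (lintegral_mono_ae ?_)
  filter_upwards [hd] with t ht
  have h1 : HasDerivAt (fun t : ℝ => x + t • h) h t := by
    simpa using ((hasDerivAt_id t).smul_const h).const_add x
  have h2 := (ht.hasFDerivAt.comp_hasDerivAt t h1).deriv
  simp only [Function.comp_def] at h2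
  rw [h2]
  exact ContinuousLinearMap.le_opENorm _ _

theorem LipschitzWith.lintegral_enorm_add_sub_le [FiniteDimensional ℝ E] [MeasurableSpace E]
    [BorelSpace E] (μ : Measure E) [μ.IsAddHaarMeasure] {C : ℝ≥0} {v : E → ℝ}
    (hv : LipschitzWith C v) {h : E} {K Ω : Set E}
    (hK : ∀ x ∈ K, ∀ t : ℝ, t ∈ Set.Ioc 0 1 → x + t • h ∈ Ω) :
    ∫⁻ x in K, ‖v (x + h) - v x‖ₑ ∂μ ≤ ‖h‖ₑ * ∫⁻ x in Ω, ‖fderiv ℝ v x‖ₑ ∂μ := by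
  have hmeas : Measurable fun q : E × ℝ => q.1 + q.2 • h := by fun_prop
  have hnull : ∀ᵐ t : ℝ ∂volume.restrict (Set.Ioc 0 1), ∀ᵐ x ∂μ.restrict K,
      DifferentiableAt ℝ v (x + t • h) := by
    refine Eventually.of_forall fun t => ae_restrict_of_ae ?_
    exact (measurePreserving_add_right μ (t • h)).quasiMeasurePreserving.ae
      hv.ae_differentiableAt
  have hset : MeasurableSet {q : E × ℝ | DifferentiableAt ℝ v (q.1 + q.2 • h)} :=
    hmeas (measurableSet_of_differentiableAt ℝ v)
  have hnull' := (Measure.ae_ae_comm (μ := μ.restrict K)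
    (ν := volume.restrict (Set.Ioc (0 : ℝ) 1))
    (p := fun x t => DifferentiableAt ℝ v (x + t • h)) hset).2 hnull
  have hfm : Measurable fun x => ‖fderiv ℝ v x‖ₑ := (measurable_fderiv ℝ v).enorm
  calc ∫⁻ x in K, ‖v (x + h) - v x‖ₑ ∂μ
      ≤ ∫⁻ x in K, ∫⁻ t in Set.Ioc (0 : ℝ) 1, ‖fderiv ℝ v (x + t • h)‖ₑ * ‖h‖ₑ ∂volume ∂μ :=
        lintegral_mono_ae (hnull'.mono fun x hx => hv.enorm_add_sub_le_lintegral_fderiv hx)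
    _ = ∫⁻ t in Set.Ioc (0 : ℝ) 1, ∫⁻ x in K, ‖fderiv ℝ v (x + t • h)‖ₑ * ‖h‖ₑ ∂μ :=
        lintegral_lintegral_swap ((hfm.comp hmeas).mul_const _).aemeasurable
    _ ≤ ∫⁻ t in Set.Ioc (0 : ℝ) 1, ‖h‖ₑ * ∫⁻ x in Ω, ‖fderiv ℝ v x‖ₑ ∂μ := by
        refine setLIntegral_mono' measurableSet_Ioc fun t ht => ?_
        rw [lintegral_mul_const' _ _ enorm_ne_top, mul_comm]
        gcongr ‖h‖ₑ * ?_
        have hpres := measurePreserving_add_right μ (t • h)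
        have hemb : MeasurableEmbedding fun x : E => x + t • h :=
          (MeasurableEquiv.addRight (t • h)).measurableEmbedding
        calc ∫⁻ x in K, ‖fderiv ℝ v (x + t • h)‖ₑ ∂μ
            ≤ ∫⁻ x in (fun x => x + t • h) ⁻¹' Ω, ‖fderiv ℝ v (x + t • h)‖ₑ ∂μ :=
              lintegral_mono_set fun x hx => hK x hx t ht
          _ = ∫⁻ x in Ω, ‖fderiv ℝ v x‖ₑ ∂μ :=
              hpres.setLIntegral_comp_preimage_emb hemb (fun x => ‖fderiv ℝ v x‖ₑ) Ω
    _ = ‖h‖ₑ * ∫⁻ x in Ω, ‖fderiv ℝ v x‖ₑ ∂μ := by simp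

theorem enorm_sub_setAverage_ball_le [MeasurableSpace E] [BorelSpace E]
    (μ : Measure E) [μ.IsAddHaarMeasure] [FiniteDimensional ℝ E] {v : E → ℝ} {x c : E} {δ : ℝ}
    (hδ : 0 < δ) (hc : dist x c < δ) (hv : IntegrableOn v (Metric.ball c δ) μ) :
    ‖v x - ⨍ y in Metric.ball c δ, v y ∂μ‖ₑ ≤
      (μ (Metric.ball 0 δ))⁻¹ * ∫⁻ h in Metric.ball 0 (2 * δ), ‖v (x + h) - v x‖ₑ ∂μ := by
  have hpos : μ (Metric.ball c δ) ≠ 0 := (Metric.measure_ball_pos μ c hδ).ne'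
  have hfin : μ (Metric.ball c δ) ≠ ∞ := measure_ball_lt_top.ne
  have hsub : v x - ⨍ y in Metric.ball c δ, v y ∂μ = ⨍ y in Metric.ball c δ, (v x - v y) ∂μ := by
    have hci : IntegrableOn (fun _ => v x) (Metric.ball c δ) μ := integrableOn_const hfin
    rw [setAverage_eq, setAverage_eq, integral_sub hci hv]
    have h1 : μ.real (Metric.ball c δ) ≠ 0 := by
      simp [Measure.real, ENNReal.toReal_eq_zero_iff, hpos, hfin]
    simp only [setIntegral_const, smul_eq_mul]
    field_simp
  rw [hsub, setAverage_eq', ← Measure.addHaar_ball_center μ c δ]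
  refine (enorm_integral_le_lintegral_enorm _).trans ?_
  rw [lintegral_smul_measure, smul_eq_mul]
  gcongr _ * ?_
  have hball : Metric.ball c δ ⊆ Metric.ball x (2 * δ) := by
    refine Metric.ball_subset_ball' ?_
    rw [dist_comm]; linarith
  calc ∫⁻ y in Metric.ball c δ, ‖v x - v y‖ₑ ∂μ
      ≤ ∫⁻ y in Metric.ball x (2 * δ), ‖v x - v y‖ₑ ∂μ := lintegral_mono_set hball
    _ = ∫⁻ h in (fun h => x + h) ⁻¹' Metric.ball x (2 * δ), ‖v x - v (x + h)‖ₑ ∂μ :=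
        ((measurePreserving_add_left μ x).setLIntegral_comp_preimage_emb
          (MeasurableEquiv.addLeft x).measurableEmbedding (fun y => ‖v x - v y‖ₑ) _).symm
    _ = ∫⁻ h in Metric.ball 0 (2 * δ), ‖v (x + h) - v x‖ₑ ∂μ := by
        rw [preimage_add_ball, sub_self]
        simp only [enorm_sub_rev]

/-- Averages over balls of radius `δ` are `L¹`-close to a function whose translations are
controlled in `L¹`. -/
theorem lintegral_enorm_sub_setAverage_ball_le [MeasurableSpace E] [BorelSpace E]
    (μ : Measure E) [μ.IsAddHaarMeasure] [FiniteDimensional ℝ E] {v : E → ℝ} {c : E → E} {δ : ℝ}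
    {K : Set E} {M : ℝ≥0∞} (hδ : 0 < δ) (hc : ∀ x, dist x (c x) < δ) (hv : Continuous v)
    (hM : ∀ h : E, ‖h‖ < 2 * δ → ∫⁻ x in K, ‖v (x + h) - v x‖ₑ ∂μ ≤ ‖h‖ₑ * M) :
    ∫⁻ x in K, ‖v x - ⨍ y in Metric.ball (c x) δ, v y ∂μ‖ₑ ∂μ ≤
      ENNReal.ofReal (2 ^ Module.finrank ℝ E) * (ENNReal.ofReal (2 * δ) * M) := by
  have hpos : μ (Metric.ball 0 δ) ≠ 0 := (Metric.measure_ball_pos μ 0 hδ).ne'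
  have hfin : μ (Metric.ball 0 δ) ≠ ∞ := measure_ball_lt_top.ne
  have hvi : ∀ x, IntegrableOn v (Metric.ball (c x) δ) μ := fun x =>
    (hv.continuousOn.integrableOn_compact (isCompact_closedBall (c x) δ)).mono_set
      Metric.ball_subset_closedBall
  have hmeas : Measurable (Function.uncurry fun x h : E => ‖v (x + h) - v x‖ₑ) := by
    have : Continuous (Function.uncurry fun x h : E => v (x + h) - v x) := by
      simp only [Function.uncurry_def]; fun_prop
    exact this.measurable.enorm
  calc ∫⁻ x in K, ‖v x - ⨍ y in Metric.ball (c x) δ, v y ∂μ‖ₑ ∂μ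
      ≤ ∫⁻ x in K, (μ (Metric.ball 0 δ))⁻¹ *
          ∫⁻ h in Metric.ball 0 (2 * δ), ‖v (x + h) - v x‖ₑ ∂μ ∂μ :=
        lintegral_mono fun x => enorm_sub_setAverage_ball_le μ hδ (hc x) (hvi x)
    _ = (μ (Metric.ball 0 δ))⁻¹ *
          ∫⁻ h in Metric.ball 0 (2 * δ), ∫⁻ x in K, ‖v (x + h) - v x‖ₑ ∂μ ∂μ := by
        rw [lintegral_const_mul' _ _ (ENNReal.inv_ne_top.2 hpos),
          lintegral_lintegral_swap hmeas.aemeasurable]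
    _ ≤ (μ (Metric.ball 0 δ))⁻¹ *
          ∫⁻ _ in Metric.ball (0 : E) (2 * δ), ENNReal.ofReal (2 * δ) * M ∂μ := by
        gcongr _ * ?_
        refine setLIntegral_mono' measurableSet_ball fun h hh => ?_
        rw [mem_ball_zero_iff] at hh
        refine (hM h hh).trans ?_
        rw [← ofReal_norm]
        gcongr
    _ = _ := by
        rw [setLIntegral_const, Measure.addHaar_ball_mul_of_pos μ _ two_pos, mul_comm _ M,
          mul_left_comm, mul_left_comm _ _ (μ _), ENNReal.inv_mul_cancel hpos hfin]
        ring

theorem exists_subseq_forall_tendsto_of_bounded {ι : Type*} [Countable ι] {a : ℕ → ι → ℝ} {C : ℝ}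
    (ha : ∀ j i, |a j i| ≤ C) :
    ∃ φ : ℕ → ℕ, StrictMono φ ∧ ∃ b : ι → ℝ, ∀ i, |b i| ≤ C ∧
      Tendsto (fun j => a (φ j) i) atTop (𝓝 (b i)) := by
  have hcpt : IsCompact (Set.univ.pi fun _ : ι => Set.Icc (-C) C) :=
    isCompact_univ_pi fun _ => isCompact_Icc
  obtain ⟨b, hb, φ, hφ, hlim⟩ := hcpt.tendsto_subseq (x := a)
    fun j i _ => abs_le.1 (ha j i)
  exact ⟨φ, hφ, b, fun i => ⟨abs_le.2 (hb i trivial), (tendsto_pi_nhds.1 hlim) i⟩⟩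

theorem exists_measurable_dist_denseSeq_lt (X : Type*) [PseudoMetricSpace X]
    [TopologicalSpace.SeparableSpace X] [Nonempty X] [MeasurableSpace X] [OpensMeasurableSpace X]
    {δ : ℝ} (hδ : 0 < δ) :
    ∃ N : X → ℕ, Measurable N ∧ ∀ x, dist x (TopologicalSpace.denseSeq X (N x)) < δ := by
  classical
  have h : ∀ x : X, ∃ N, dist x (TopologicalSpace.denseSeq X N) < δ := fun x =>
    (TopologicalSpace.denseRange_denseSeq X).exists_dist_lt x hδ
  exact ⟨fun x => Nat.find (h x),
    measurable_find h fun N => (isOpen_lt (by fun_prop) continuous_const).measurableSet,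
    fun x => Nat.find_spec (h x)⟩

theorem abs_setAverage_le {α : Type*} [MeasurableSpace α] {μ : Measure α} {s : Set α}
    {v : α → ℝ} {C : ℝ} (hs : μ s ≠ ∞) (hC : 0 ≤ C) (hv : ∀ x, |v x| ≤ C) :
    |⨍ y in s, v y ∂μ| ≤ C := by
  have : IsFiniteMeasure (μ.restrict s) := ⟨by simpa using hs.lt_top⟩
  rw [average_eq]
  have h := norm_integral_le_of_norm_le_const (μ := μ.restrict s) (f := v) (C := C)
    (Eventually.of_forall hv)
  rw [smul_eq_mul, abs_mul, abs_of_nonneg (by positivity)]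
  rw [Real.norm_eq_abs] at h
  rcases eq_or_lt_of_le (measureReal_nonneg (μ := μ.restrict s) (s := Set.univ)) with h0 | h0
  · simpa [← h0] using hC
  · rw [inv_mul_le_iff₀ h0, mul_comm]; exact h

theorem exists_eventually_lintegral_enorm_sub_le [MeasurableSpace E] [BorelSpace E]
    (μ : Measure E) [μ.IsAddHaarMeasure] [FiniteDimensional ℝ E] {w : ℕ → E → ℝ} {C : ℝ}
    {Ω : Set E} {M : ℝ≥0∞} (hΩ : IsOpen Ω) (hΩfin : μ Ω ≠ ∞) (hMfin : M ≠ ∞)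
    (hw : ∀ j, Continuous (w j)) (hC : ∀ j x, |w j x| ≤ C)
    (hM : ∀ K, IsCompact K → K ⊆ Ω → ∃ r > 0, ∀ j, ∀ h : E, ‖h‖ < r →
      ∫⁻ x in K, ‖w j (x + h) - w j x‖ₑ ∂μ ≤ ‖h‖ₑ * M)
    {b : ℕ × ℕ → ℝ}
    (hb : ∀ i, |b i| ≤ C ∧ Tendsto (fun j =>
      ⨍ y in Metric.ball (TopologicalSpace.denseSeq E i.2) (1 / ((i.1 : ℝ) + 1)), w j y ∂μ)
      atTop (𝓝 (b i)))
    {η : ℝ≥0∞} (hη : η ≠ 0) :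
    ∃ g : E → ℝ, Measurable g ∧ ∀ᶠ j in atTop, ∫⁻ x in Ω, ‖w j x - g x‖ₑ ∂μ ≤ η := by
  have hC0 : 0 ≤ C := (abs_nonneg _).trans (hC 0 0)
  have hη3 : η / 3 ≠ 0 := by simp [hη]
  obtain ⟨K, hKΩ, hK, hKμ⟩ : ∃ K ⊆ Ω, IsCompact K ∧
      ENNReal.ofReal (2 * C) * μ (Ω \ K) ≤ η / 3 := by
    by_cases hC1 : ENNReal.ofReal (2 * C) = 0
    · exact ⟨∅, by simp, isCompact_empty, by simp [hC1]⟩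
    obtain ⟨K, hKΩ, hK, h⟩ := hΩ.measurableSet.exists_isCompact_sdiff_lt hΩfin
      (ENNReal.div_ne_zero.2 ⟨hη3, (ENNReal.ofReal_ne_top (r := 2 * C))⟩)
    refine ⟨K, hKΩ, hK, (mul_le_mul_right h.le _).trans ENNReal.mul_div_le⟩
  obtain ⟨r, hr, hrM⟩ := hM K hK hKΩ
  obtain ⟨k, hkr, hkη⟩ : ∃ k : ℕ, 2 * (1 / ((k : ℝ) + 1)) < r ∧
      ENNReal.ofReal (2 ^ Module.finrank ℝ E) *
        (ENNReal.ofReal (2 * (1 / ((k : ℝ) + 1))) * M) < η / 3 := by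
    have h0 : Tendsto (fun k : ℕ => 2 * (1 / ((k : ℝ) + 1))) atTop (𝓝 0) := by
      simpa using (tendsto_one_div_add_atTop_nhds_zero_nat (𝕜 := ℝ)).const_mul 2
    have h1 : Tendsto (fun k : ℕ => ENNReal.ofReal (2 ^ Module.finrank ℝ E) *
        (ENNReal.ofReal (2 * (1 / ((k : ℝ) + 1))) * M)) atTop (𝓝 0) := by
      have h2 := ENNReal.Tendsto.mul_const (ENNReal.tendsto_ofReal h0) (Or.inr hMfin)
      have h3 := ENNReal.Tendsto.const_mul h2
        (Or.inr (ENNReal.ofReal_ne_top (r := 2 ^ Module.finrank ℝ E)))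
      simpa using h3
    exact ((h0.eventually_lt_const hr).and
      (h1.eventually_lt_const (pos_iff_ne_zero.2 hη3))).exists
  set δ : ℝ := 1 / ((k : ℝ) + 1) with hδ
  have hδ0 : 0 < δ := by positivity
  obtain ⟨N, hNm, hN⟩ := exists_measurable_dist_denseSeq_lt E hδ0
  let P : ℕ → E → ℝ := fun j x =>
    ⨍ y in Metric.ball (TopologicalSpace.denseSeq E (N x)) δ, w j y ∂μ
  have hPm : ∀ j, Measurable (P j) := fun j =>
    (measurable_of_countable fun i : ℕ =>
      ⨍ y in Metric.ball (TopologicalSpace.denseSeq E i) δ, w j y ∂μ).comp hNm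
  let g : E → ℝ := fun x => b (k, N x)
  have hgm : Measurable g := (measurable_of_countable fun i : ℕ => b (k, i)).comp hNm
  have hlim : Tendsto (fun j => ∫⁻ x in K, ‖P j x - g x‖ₑ ∂μ) atTop (𝓝 0) := by
    have := tendsto_lintegral_of_dominated_convergence (μ := μ.restrict K)
      (F := fun j x => ‖P j x - g x‖ₑ) (f := fun _ => 0) (fun _ => ENNReal.ofReal (2 * C))
      (fun j => ((hPm j).sub hgm).enorm) (fun j => Eventually.of_forall fun x => ?_)
      ?_ (Eventually.of_forall fun x => ?_)
    · simpa using this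
    · dsimp only
      rw [← ofReal_norm]
      refine ENNReal.ofReal_le_ofReal ((norm_sub_le _ _).trans ?_)
      have h1 : ‖P j x‖ ≤ C := abs_setAverage_le measure_ball_lt_top.ne hC0 (hC j)
      have h2 : ‖g x‖ ≤ C := (hb (k, N x)).1
      linarith
    · rw [setLIntegral_const]
      exact ENNReal.mul_ne_top ENNReal.ofReal_ne_top hK.measure_lt_top.ne
    · have h1 : Tendsto (fun j => P j x - g x) atTop (𝓝 0) := by
        simpa [g, P, hδ] using (hb (k, N x)).2.sub_const (b (k, N x))
      simpa using h1.enorm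
  refine ⟨g, hgm, ?_⟩
  filter_upwards [hlim.eventually_le_const (pos_iff_ne_zero.2 hη3)] with j hj
  have hsplit : ∫⁻ x in Ω, ‖w j x - g x‖ₑ ∂μ =
      ∫⁻ x in K, ‖w j x - g x‖ₑ ∂μ + ∫⁻ x in Ω \ K, ‖w j x - g x‖ₑ ∂μ := by
    rw [← lintegral_union (hΩ.measurableSet.diff hK.measurableSet) Set.disjoint_sdiff_right,
      Set.union_sdiff_cancel hKΩ]
  have hout : ∫⁻ x in Ω \ K, ‖w j x - g x‖ₑ ∂μ ≤ η / 3 := by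
    refine le_trans ?_ hKμ
    rw [← setLIntegral_const]
    refine lintegral_mono fun x => ?_
    rw [← ofReal_norm]
    refine ENNReal.ofReal_le_ofReal ((norm_sub_le _ _).trans ?_)
    have h1 : ‖w j x‖ ≤ C := hC j x
    have h2 : ‖g x‖ ≤ C := (hb (k, N x)).1
    linarith
  have hin : ∫⁻ x in K, ‖w j x - g x‖ₑ ∂μ ≤ η / 3 + η / 3 := by
    calc ∫⁻ x in K, ‖w j x - g x‖ₑ ∂μ
        ≤ ∫⁻ x in K, (‖w j x - P j x‖ₑ + ‖P j x - g x‖ₑ) ∂μ := by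
          refine lintegral_mono fun x => ?_
          rw [← sub_add_sub_cancel (w j x) (P j x) (g x)]
          exact enorm_add_le _ _
      _ = ∫⁻ x in K, ‖w j x - P j x‖ₑ ∂μ + ∫⁻ x in K, ‖P j x - g x‖ₑ ∂μ :=
          lintegral_add_left ((hw j).measurable.sub (hPm j)).enorm _
      _ ≤ η / 3 + η / 3 := by
          refine add_le_add ?_ hj
          exact (lintegral_enorm_sub_setAverage_ball_le μ hδ0 hN (hw j)
            fun h hh => hrM j h (hh.trans hkr)).trans hkη.le
  rw [hsplit]
  exact (add_le_add hin hout).trans (ENNReal.add_thirds η).le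

/-- A uniformly bounded sequence whose small translations are uniformly controlled in `L¹` on
compact subsets of `Ω` has a subsequence converging almost everywhere in `Ω`. -/
theorem exists_subseq_ae_tendsto_of_translation_le [MeasurableSpace E] [BorelSpace E]
    (μ : Measure E) [μ.IsAddHaarMeasure] [FiniteDimensional ℝ E] {v : ℕ → E → ℝ} {C : ℝ}
    {Ω : Set E} {M : ℝ≥0∞} (hΩ : IsOpen Ω) (hΩfin : μ Ω ≠ ∞) (hMfin : M ≠ ∞)
    (hv : ∀ j, Continuous (v j)) (hC : ∀ j x, |v j x| ≤ C)
    (hM : ∀ K, IsCompact K → K ⊆ Ω → ∃ r > 0, ∀ j, ∀ h : E, ‖h‖ < r →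
      ∫⁻ x in K, ‖v j (x + h) - v j x‖ₑ ∂μ ≤ ‖h‖ₑ * M) :
    ∃ φ : ℕ → ℕ, StrictMono φ ∧ ∃ g : E → ℝ,
      ∀ᵐ x ∂μ.restrict Ω, Tendsto (fun j => v (φ j) x) atTop (𝓝 (g x)) := by
  have hC0 : 0 ≤ C := (abs_nonneg _).trans (hC 0 0)
  obtain ⟨φ, hφ, b, hb⟩ := exists_subseq_forall_tendsto_of_bounded
    (a := fun j (i : ℕ × ℕ) =>
      ⨍ y in Metric.ball (TopologicalSpace.denseSeq E i.2) (1 / ((i.1 : ℝ) + 1)), v j y ∂μ)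
    (fun j i => abs_setAverage_le measure_ball_lt_top.ne hC0 (hC j))
  have : IsFiniteMeasure (μ.restrict Ω) := ⟨by simpa using hΩfin.lt_top⟩
  have hmem : ∀ j, MemLp (v (φ j)) 1 (μ.restrict Ω) := fun j =>
    MemLp.of_bound (hv _).aestronglyMeasurable C (Eventually.of_forall (hC _))
  have hcauchy : CauchySeq fun j => (hmem j).toLp (v (φ j)) := by
    rw [EMetric.cauchySeq_iff]
    intro η' hη'
    obtain ⟨η, hη, hηη'⟩ := exists_between hη'
    obtain ⟨g, hgm, hg⟩ := exists_eventually_lintegral_enorm_sub_le μ hΩ hΩfin hMfin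
      (fun j => hv (φ j)) (fun j => hC (φ j))
      (fun K hK hKΩ => (hM K hK hKΩ).imp fun r hr => ⟨hr.1, fun j => hr.2 (φ j)⟩) hb
      (η := η / 2) (by simpa using hη.ne')
    obtain ⟨J, hJ⟩ := eventually_atTop.1 hg
    refine ⟨J, fun i hi l hl => lt_of_le_of_lt ?_ hηη'⟩
    rw [Lp.edist_toLp_toLp, eLpNorm_one_eq_lintegral_enorm]
    calc ∫⁻ x in Ω, ‖(v (φ i) - v (φ l)) x‖ₑ ∂μ
        ≤ ∫⁻ x in Ω, (‖v (φ i) x - g x‖ₑ + ‖v (φ l) x - g x‖ₑ) ∂μ := by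
          refine lintegral_mono fun x => ?_
          rw [Pi.sub_apply, ← sub_sub_sub_cancel_right _ _ (g x)]
          exact enorm_sub_le
      _ = ∫⁻ x in Ω, ‖v (φ i) x - g x‖ₑ ∂μ + ∫⁻ x in Ω, ‖v (φ l) x - g x‖ₑ ∂μ :=
          lintegral_add_left ((hv _).measurable.sub hgm).enorm _
      _ ≤ η / 2 + η / 2 := add_le_add (hJ i hi) (hJ l hl)
      _ = η := ENNReal.add_halves η
  obtain ⟨G, hG⟩ := cauchySeq_tendsto_of_complete hcauchy
  obtain ⟨ψ, hψ, hae⟩ := (tendstoInMeasure_of_tendsto_Lp hG).exists_seq_tendsto_ae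
  refine ⟨φ ∘ ψ, hφ.comp hψ, G, ?_⟩
  have hcoe : ∀ᵐ x ∂μ.restrict Ω, ∀ j, (hmem j).toLp (v (φ j)) x = v (φ j) x :=
    ae_all_iff.2 fun j => (hmem j).coeFn_toLp
  filter_upwards [hae, hcoe] with x hx hx'
  simpa [hx'] using hx

end TranslationCompactness

theorem IsCompact.exists_tendsto_of_tendsto_comp {X Y : Type*} [TopologicalSpace X]
    [TopologicalSpace Y] [T2Space Y] {K : Set X} (hK : IsCompact K) {Φ : X → Y}
    (hΦ : Continuous Φ) (hinj : Set.InjOn Φ K) {s : ℕ → X} (hs : ∀ j, s j ∈ K) {L : Y}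
    (hL : Tendsto (fun j => Φ (s j)) atTop (𝓝 L)) :
    ∃ a ∈ K, Tendsto s atTop (𝓝 a) := by
  have hval : ∀ b, MapClusterPt b atTop s → Φ b = L := fun b hb =>
    eq_of_nhds_neBot (ClusterPt.mono (hb.tendsto_comp hΦ.continuousAt) hL)
  obtain ⟨a, ha, hclus⟩ := hK.exists_mapClusterPt_of_frequently
    (Eventually.of_forall hs : ∀ᶠ j in atTop, s j ∈ K).frequently
  refine ⟨a, ha, hK.tendsto_nhds_of_unique_mapClusterPt (Eventually.of_forall hs)
    fun b hb hb' => hinj hb ha ((hval b hb').trans (hval a hclus).symm)⟩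

theorem exists_hasDerivAt_abs_one_sub_sq_rpow {q : ℝ} (hq : 0 ≤ q) :
    ∃ Φ : ℝ → ℝ, (∀ t, HasDerivAt Φ (|1 - t ^ 2| ^ q) t) ∧
      StrictMonoOn Φ (Set.Icc (-1) 1) := by
  have hcont : Continuous fun t : ℝ => |1 - t ^ 2| ^ q :=
    (by fun_prop : Continuous fun t : ℝ => |1 - t ^ 2|).rpow_const fun _ => Or.inr hq
  have hder : ∀ t, HasDerivAt (fun t => ∫ s in (0 : ℝ)..t, |1 - s ^ 2| ^ q) (|1 - t ^ 2| ^ q) t :=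
    fun t => intervalIntegral.integral_hasDerivAt_right (hcont.intervalIntegrable _ _)
      (hcont.stronglyMeasurableAtFilter _ _) hcont.continuousAt
  refine ⟨_, hder, strictMonoOn_of_deriv_pos (convex_Icc _ _)
    (fun t _ => (hder t).continuousAt.continuousWithinAt) fun t ht => ?_⟩
  rw [interior_Icc] at ht
  rw [(hder t).deriv]
  have : 0 < 1 - t ^ 2 := by nlinarith [ht.1, ht.2]
  positivity

theorem abs_one_sub_sq_rpow_le_one {t q : ℝ} (hq : 0 ≤ q) (ht : t ∈ Set.Icc (-1 : ℝ) 1) :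
    |1 - t ^ 2| ^ q ≤ 1 := by
  refine Real.rpow_le_one (abs_nonneg _) ?_ hq
  rw [abs_le]; constructor <;> nlinarith [ht.1, ht.2]

theorem mul_abs_one_sub_sq_rpow_le {p m a t : ℝ} (hp : 1 < p) (ha : 0 ≤ a) :
    a * |1 - t ^ 2| ^ (m * (p - 1) / p) ≤ a ^ p + |1 - t ^ 2| ^ m := by
  have hp' : 0 < p - 1 := by linarith
  have hp0 : 0 < p := by linarith
  have hconj : p.HolderConjugate (p / (p - 1)) := Real.HolderConjugate.conjExponent hp
  have hb : 0 ≤ |1 - t ^ 2| := abs_nonneg _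
  have hy := Real.young_inequality_of_nonneg ha
    (Real.rpow_nonneg hb (m * (p - 1) / p)) hconj
  rw [← Real.rpow_mul hb, show m * (p - 1) / p * (p / (p - 1)) = m by field_simp] at hy
  exact hy.trans (add_le_add (div_le_self (by positivity) hp.le)
    (div_le_self (by positivity) hconj.symm.lt.le))

/-- The potential and gradient parts of the energy, integrated together, are controlled by the
full energy. -/
theorem lintegral_two_well_le {n : ℕ} {Ω : Set (EuclideanSpace ℝ (Fin n))}
    (hΩfin : volume Ω ≠ ∞)
    {En : EuclideanSpace ℝ (Fin n) → ℝ → EuclideanSpace ℝ (Fin n) → ℝ}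
    (hEmeas : Measurable fun q : EuclideanSpace ℝ (Fin n) × ℝ × EuclideanSpace ℝ (Fin n) =>
      En q.1 q.2.1 q.2.2)
    {lam Lam p m : ℝ} (hlam : 0 < lam) (hLam : 1 ≤ Lam) (hp : 0 ≤ p) (hm : 0 ≤ m)
    (hlow : ∀ x τ ξ, lam * (‖ξ‖ ^ p + |1 - τ ^ 2| ^ m) ≤ En x τ ξ)
    (hupp : ∀ x τ ξ, En x τ ξ ≤ Lam * (‖ξ‖ ^ p + |1 - τ ^ 2| ^ m))
    {ε M : ℝ} (hε : 0 < ε) {w : EuclideanSpace ℝ (Fin n) → ℝ} {C : ℝ≥0}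
    (hw : LipschitzWith C w) (hwr : ∀ x, w x ∈ Set.Icc (-1 : ℝ) 1)
    (hM : (1 / ε) * ∫ x in Ω, En x (w x) (ε • gradient w x) ≤ M) :
    ∫⁻ x in Ω, ENNReal.ofReal (‖ε • gradient w x‖ ^ p + |1 - w x ^ 2| ^ m) ≤
      ENNReal.ofReal (ε * (M / lam)) := by
  have hgm : Measurable (gradient w) :=
    (InnerProductSpace.toDual ℝ (EuclideanSpace ℝ (Fin n))).symm.continuous.measurable.comp
      (measurable_fderiv ℝ w)
  have hFm : Measurable fun x => En x (w x) (ε • gradient w x) :=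
    hEmeas.comp (measurable_id.prodMk (hw.continuous.measurable.prodMk (hgm.const_smul ε)))
  have hgb : ∀ x, ‖ε • gradient w x‖ ≤ ε * C := fun x => by
    rw [norm_smul, Real.norm_of_nonneg hε.le, gradient, LinearIsometryEquiv.norm_map]
    gcongr
    exact norm_fderiv_le_of_lipschitz ℝ hw
  have hpos : ∀ x, 0 ≤ En x (w x) (ε • gradient w x) := fun x =>
    (by positivity : 0 ≤ lam * (‖ε • gradient w x‖ ^ p + |1 - w x ^ 2| ^ m)).trans (hlow _ _ _)
  have : IsFiniteMeasure (volume.restrict Ω) := ⟨by simpa using hΩfin.lt_top⟩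
  have hint : Integrable (fun x => En x (w x) (ε • gradient w x)) (volume.restrict Ω) := by
    refine Integrable.of_bound hFm.aestronglyMeasurable (Lam * ((ε * C) ^ p + 1))
      (Eventually.of_forall fun x => ?_)
    rw [Real.norm_of_nonneg (hpos x)]
    refine (hupp _ _ _).trans ?_
    gcongr
    · exact hgb x
    · exact abs_one_sub_sq_rpow_le_one hm (hwr x)
  calc ∫⁻ x in Ω, ENNReal.ofReal (‖ε • gradient w x‖ ^ p + |1 - w x ^ 2| ^ m)
      ≤ ∫⁻ x in Ω, ENNReal.ofReal (En x (w x) (ε • gradient w x) / lam) := by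
        refine lintegral_mono fun x => ENNReal.ofReal_le_ofReal ?_
        rw [le_div_iff₀ hlam, mul_comm]
        exact hlow _ _ _
    _ = ENNReal.ofReal (∫ x in Ω, En x (w x) (ε • gradient w x) / lam) :=
        (ofReal_integral_eq_lintegral_ofReal (hint.div_const lam)
          (Eventually.of_forall fun x => div_nonneg (hpos x) hlam.le)).symm
    _ ≤ ENNReal.ofReal (ε * (M / lam)) := by
        refine ENNReal.ofReal_le_ofReal ?_
        rw [integral_div, ← mul_div_assoc]
        gcongr
        rwa [one_div, inv_mul_le_iff₀ hε] at hM

/-- The Modica–Mortola estimate. -/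
theorem lintegral_enorm_fderiv_comp_le {n : ℕ} {Ω : Set (EuclideanSpace ℝ (Fin n))}
    {p m ε M : ℝ} (hp : 1 < p) (hε : 0 < ε) {w : EuclideanSpace ℝ (Fin n) → ℝ} {C : ℝ≥0}
    (hw : LipschitzWith C w) {Φ : ℝ → ℝ}
    (hΦ : ∀ t, HasDerivAt Φ (|1 - t ^ 2| ^ (m * (p - 1) / p)) t)
    (hM : ∫⁻ x in Ω, ENNReal.ofReal (‖ε • gradient w x‖ ^ p + |1 - w x ^ 2| ^ m) ≤
      ENNReal.ofReal (ε * M)) :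
    ∫⁻ x in Ω, ‖fderiv ℝ (fun y => Φ (w y)) x‖ₑ ≤ ENNReal.ofReal M := by
  calc ∫⁻ x in Ω, ‖fderiv ℝ (fun y => Φ (w y)) x‖ₑ
      ≤ ∫⁻ x in Ω, ENNReal.ofReal ε⁻¹ *
          ENNReal.ofReal (‖ε • gradient w x‖ ^ p + |1 - w x ^ 2| ^ m) := by
        refine lintegral_mono_ae (ae_restrict_of_ae ?_)
        filter_upwards [hw.ae_differentiableAt (μ := volume)] with x hx
        have hd := ((hΦ (w x)).comp_hasFDerivAt x hx.hasFDerivAt).fderiv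
        simp only [Function.comp_def] at hd
        rw [hd, ← ofReal_norm, ← ENNReal.ofReal_mul (by positivity)]
        refine ENNReal.ofReal_le_ofReal ?_
        rw [norm_smul, Real.norm_of_nonneg (by positivity), ← div_eq_inv_mul, le_div_iff₀ hε]
        have hgrad : ‖ε • gradient w x‖ = ε * ‖fderiv ℝ w x‖ := by
          rw [norm_smul, Real.norm_of_nonneg hε.le, gradient, LinearIsometryEquiv.norm_map]
        have hy := mul_abs_one_sub_sq_rpow_le (m := m) (t := w x) hp
          (norm_nonneg (ε • gradient w x))
        refine le_trans (le_of_eq ?_) hy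
        rw [hgrad]; ring
    _ = ENNReal.ofReal ε⁻¹ *
          ∫⁻ x in Ω, ENNReal.ofReal (‖ε • gradient w x‖ ^ p + |1 - w x ^ 2| ^ m) :=
        lintegral_const_mul' _ _ ENNReal.ofReal_ne_top
    _ ≤ ENNReal.ofReal ε⁻¹ * ENNReal.ofReal (ε * M) := by gcongr
    _ = ENNReal.ofReal M := by
        rw [← ENNReal.ofReal_mul (by positivity), inv_mul_cancel_left₀ hε.ne']

theorem LipschitzOnWith.exists_lipschitzWith_mem_Icc {X : Type*} [PseudoMetricSpace X]
    {C : ℝ≥0} {s : Set X} {f : X → ℝ} (hf : LipschitzOnWith C f s) {a b : ℝ} (hab : a ≤ b)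
    (hr : ∀ x ∈ s, f x ∈ Set.Icc a b) :
    ∃ w : X → ℝ, LipschitzWith C w ∧ (∀ x, w x ∈ Set.Icc a b) ∧ Set.EqOn f w s := by
  obtain ⟨g, hg, heq⟩ := hf.extend_real
  refine ⟨fun x => max a (min b (g x)), (hg.const_min b).const_max a,
    fun x => ⟨le_max_left _ _, max_le hab (min_le_left _ _)⟩, fun x hx => ?_⟩
  have := hr x hx
  simp only [← heq hx, min_eq_right this.2, max_eq_right this.1]

theorem exists_subseq_ae_tendsto_zero {α : Type*} [MeasurableSpace α] {μ : Measure α}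
    {f : ℕ → α → ℝ} (hf : ∀ j, Measurable (f j))
    (h : Tendsto (fun j => ∫⁻ x, ‖f j x‖ₑ ∂μ) atTop (𝓝 0)) :
    ∃ ψ : ℕ → ℕ, StrictMono ψ ∧ ∀ᵐ x ∂μ, Tendsto (fun j => f (ψ j) x) atTop (𝓝 0) := by
  refine (tendstoInMeasure_of_tendsto_eLpNorm (p := 1) (f := f) (g := fun _ => 0) one_ne_zero
    (fun j => (hf j).aestronglyMeasurable) aestronglyMeasurable_const ?_).exists_seq_tendsto_ae
  simpa [eLpNorm_one_eq_lintegral_enorm] using h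

/-- `L¹_loc` compactness of the rescaled `Q`-minima (first part of Corollary 1.3):
up to a subsequence, `u_{ε_j}` converges in `L¹_loc(Ω)` to `χ_E - χ_{ℝⁿ∖E}`. -/
theorem L1loc_convergence_to_pure_phases
    (n : ℕ) (hn : 1 ≤ n)
    (Ω : Set (EuclideanSpace ℝ (Fin n))) (hΩo : IsOpen Ω) (hΩb : Bornology.IsBounded Ω)
    (En : EuclideanSpace ℝ (Fin n) → ℝ → EuclideanSpace ℝ (Fin n) → ℝ)
    (hEmeas : Measurable fun q : EuclideanSpace ℝ (Fin n) × ℝ × EuclideanSpace ℝ (Fin n) =>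
      En q.1 q.2.1 q.2.2)
    (lam Lam p m Q : ℝ)
    (hlam : lam ∈ Set.Ioc (0 : ℝ) 1) (hLam : 1 ≤ Lam)
    (hp : 1 < p) (hm : p < m) (hQ : 1 ≤ Q)
    (hlow : ∀ (x : EuclideanSpace ℝ (Fin n)) (τ : ℝ) (ξ : EuclideanSpace ℝ (Fin n)),
      lam * (‖ξ‖ ^ p + |1 - τ ^ 2| ^ m) ≤ En x τ ξ)
    (hupp : ∀ (x : EuclideanSpace ℝ (Fin n)) (τ : ℝ) (ξ : EuclideanSpace ℝ (Fin n)),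
      En x τ ξ ≤ Lam * (‖ξ‖ ^ p + |1 - τ ^ 2| ^ m))
    (hsub : (n : ℝ) < p * m / (m - p))
    (ε : ℕ → ℝ) (hε : ∀ j, 0 < ε j) (hε0 : Tendsto ε atTop (𝓝 0))
    (u : ℕ → EuclideanSpace ℝ (Fin n) → ℝ)
    (hulip : ∀ j, ∃ K, LipschitzOnWith K (u j) Ω)
    (hur : ∀ j, ∀ x ∈ Ω, u j x ∈ Set.Icc (-1 : ℝ) 1)
    (hmin : ∀ j, IsQMinimum n
      (fun x τ ξ => (1 / ε j) * En x τ (ε j • ξ)) Q Ω (u j))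
    (hgradbd : ∃ M : ℝ, ∀ j, ∀ x ∈ Ω, ε j * ‖gradient (u j) x‖ ≤ M)
    (henbd : ∃ M : ℝ, ∀ j,
      (1 / ε j) * (∫ x in Ω, En x (u j x) (ε j • gradient (u j) x)) ≤ M) :
    ∃ Efin : Set (EuclideanSpace ℝ (Fin n)), MeasurableSet Efin ∧ Efin ⊆ Ω ∧
      ∃ φ : ℕ → ℕ, StrictMono φ ∧
        ∀ K : Set (EuclideanSpace ℝ (Fin n)), IsCompact K → K ⊆ Ω →
          Tendsto (fun i => ∫ x in K,
            |u (φ i) x - (if x ∈ Efin then (1 : ℝ) else -1)|) atTop (𝓝 0) := by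
  have hp0 : 0 < p := by linarith
  have hm0 : 0 < m := by linarith
  have hΩfin : volume Ω ≠ ∞ := hΩb.measure_lt_top.ne
  have hlam0 : 0 < lam := hlam.1
  obtain ⟨M, hM⟩ := henbd
  choose C hC using hulip
  choose w hwlip hwr hwu using fun j =>
    (hC j).exists_lipschitzWith_mem_Icc (by norm_num : (-1 : ℝ) ≤ 1) (hur j)
  have hwm : ∀ j, Measurable (w j) := fun j => (hwlip j).continuous.measurable
  have hwM : ∀ j, (1 / ε j) * ∫ x in Ω, En x (w j x) (ε j • gradient (w j) x) ≤ M := fun j => by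
    refine le_trans (le_of_eq ?_) (hM j)
    congr 1
    refine setIntegral_congr_fun hΩo.measurableSet fun x hx => ?_
    have hloc : u j =ᶠ[𝓝 x] w j := by
      filter_upwards [hΩo.mem_nhds hx] with y hy using hwu j hy
    simp only [hwu j hx, hloc.gradient_eq]
  have hen := fun j => lintegral_two_well_le hΩfin hEmeas hlam0 hLam hp0.le hm0.le hlow hupp
    (hε j) (hwlip j) (hwr j) (hwM j)
  have hq : 0 ≤ m * (p - 1) / p := div_nonneg (mul_nonneg hm0.le (by linarith)) hp0.le
  obtain ⟨Φ, hΦ, hΦmono⟩ := exists_hasDerivAt_abs_one_sub_sq_rpow hq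
  have hΦc : Continuous Φ := continuous_iff_continuousAt.2 fun t => (hΦ t).continuousAt
  have hΦlip : LipschitzOnWith 1 Φ (Set.Icc (-1) 1) :=
    (convex_Icc _ _).lipschitzOnWith_of_nnnorm_hasDerivWithin_le
      (fun t _ => (hΦ t).hasDerivWithinAt) fun t ht => by
        rw [← NNReal.coe_le_coe, coe_nnnorm, Real.norm_of_nonneg (by positivity)]
        exact abs_one_sub_sq_rpow_le_one hq ht
  obtain ⟨B, hB⟩ := isCompact_Icc.exists_bound_of_continuousOn
    (hΦc.continuousOn (s := Set.Icc (-1) 1))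
  have hvlip : ∀ j, LipschitzWith (1 * C j) fun x => Φ (w j x) := fun j =>
    lipschitzOnWith_univ.1 (hΦlip.comp (hwlip j).lipschitzOnWith fun x _ => hwr j x)
  obtain ⟨φ, hφ, g, hg⟩ := exists_subseq_ae_tendsto_of_translation_le volume
    (v := fun j x => Φ (w j x)) (C := B) hΩo hΩfin (ENNReal.ofReal_ne_top (r := M / lam))
    (fun j => (hvlip j).continuous) (fun j x => hB _ (hwr j x)) fun K hK hKΩ => by
      obtain ⟨r, hr, hrΩ⟩ := hK.exists_thickening_subset_open hΩo hKΩ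
      refine ⟨r, hr, fun j h hh => ?_⟩
      refine ((hvlip j).lintegral_enorm_add_sub_le volume (Ω := Ω) fun x hx t ht => ?_).trans
        (mul_le_mul_right (lintegral_enorm_fderiv_comp_le hp (hε j) (hwlip j) hΦ (hen j)) _)
      refine hrΩ (Metric.mem_thickening_iff.2 ⟨x, hx, ?_⟩)
      rw [dist_self_add_left, norm_smul, Real.norm_of_nonneg ht.1.le]
      exact (mul_le_of_le_one_left (norm_nonneg h) ht.2).trans_lt hh
  obtain ⟨ψ, hψ, hpot⟩ := exists_subseq_ae_tendsto_zero (μ := volume.restrict Ω)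
    (f := fun j x => |1 - w (φ j) x ^ 2| ^ m)
    (fun j => ((((hwm _).pow_const 2).const_sub 1).abs).pow_const m) <| by
      have hlim : Tendsto (fun j => ENNReal.ofReal (ε (φ j) * (M / lam))) atTop (𝓝 0) := by
        simpa using ENNReal.tendsto_ofReal ((hε0.comp hφ.tendsto_atTop).mul_const (M / lam))
      refine tendsto_of_tendsto_of_tendsto_of_le_of_le tendsto_const_nhds hlim
        (fun _ => zero_le) fun j => (lintegral_mono fun x => ?_).trans (hen (φ j))
      rw [← ofReal_norm, Real.norm_of_nonneg (by positivity)]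
      exact ENNReal.ofReal_le_ofReal (le_add_of_nonneg_left (by positivity))
  set θ := φ ∘ ψ
  obtain ⟨A, hA⟩ : ∃ A, A = Ω ∩ {x | Tendsto (fun i => w (θ i) x) atTop (𝓝 1)} := ⟨_, rfl⟩
  have hAm : MeasurableSet A := hA ▸
    hΩo.measurableSet.inter (measurableSet_tendsto (𝓝 1) fun i => hwm (θ i))
  have hae : ∀ᵐ x ∂volume.restrict Ω,
      Tendsto (fun i => w (θ i) x) atTop (𝓝 (if x ∈ A then (1 : ℝ) else -1)) := by
    filter_upwards [hg, hpot, ae_restrict_mem hΩo.measurableSet] with x hgx hpx hx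
    obtain ⟨a, -, ha⟩ := isCompact_Icc.exists_tendsto_of_tendsto_comp hΦc hΦmono.injOn
      (fun i => hwr (θ i) x) (hgx.comp hψ.tendsto_atTop)
    have hlim : Tendsto (fun i => |1 - w (θ i) x ^ 2| ^ m) atTop (𝓝 (|1 - a ^ 2| ^ m)) :=
      ((tendsto_const_nhds.sub (ha.pow 2)).abs).rpow_const (Or.inr hm0.le)
    have ha0 : |1 - a ^ 2| ^ m = 0 := tendsto_nhds_unique hlim hpx
    rw [Real.rpow_eq_zero (abs_nonneg _) hm0.ne', abs_eq_zero, sub_eq_zero] at ha0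
    rcases (by simpa using ha0.symm : a = 1 ∨ a = -1) with rfl | rfl
    · rwa [if_pos (hA ▸ ⟨hx, ha⟩)]
    · rwa [if_neg]
      intro h
      rw [hA] at h
      have := tendsto_nhds_unique ha h.2
      norm_num at this
  refine ⟨A, hAm, hA ▸ Set.inter_subset_left, θ, hφ.comp hψ, fun K hK hKΩ => ?_⟩
  have hχm : Measurable fun x => if x ∈ A then (1 : ℝ) else -1 :=
    Measurable.ite hAm measurable_const measurable_const
  have hcongr : ∀ i, ∫ x in K, |u (θ i) x - (if x ∈ A then (1 : ℝ) else -1)| =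
      ∫ x in K, |w (θ i) x - (if x ∈ A then (1 : ℝ) else -1)| := fun i =>
    setIntegral_congr_fun hK.measurableSet fun x hx => by simp only [hwu (θ i) (hKΩ hx)]
  rw [tendsto_congr hcongr]
  have hdom := tendsto_integral_of_dominated_convergence (μ := volume.restrict K)
    (F := fun i x => |w (θ i) x - (if x ∈ A then (1 : ℝ) else -1)|) (f := fun _ => 0)
    (fun _ => 2) (fun i => ((hwm _).sub hχm).abs.aestronglyMeasurable)
    (integrableOn_const hK.measure_lt_top.ne)
    (fun i => Eventually.of_forall fun x => ?_) ?_
  · simpa using hdom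
  · obtain ⟨h1, h2⟩ := hwr (θ i) x
    rw [Real.norm_eq_abs, abs_abs, abs_le]
    split_ifs <;> constructor <;> linarith
  · filter_upwards [ae_restrict_of_ae_restrict_of_subset hKΩ hae] with x hx
    simpa using (hx.sub_const (if x ∈ A then (1 : ℝ) else -1)).abs
end

section
/- Let p ∈ (1,∞), m ∈ (p,∞), R > 0, and define v : B_R → ℝ by v(x) = 2(1 + R − |x|)^{−p/(m−p)} − 1, where B_R ⊂ ℝⁿ is the open ball of radius R centered at the origin. Then for every x ∈ B_R with x ≠ 0, v is differentiable at x and |∇v(x)|^p = 2^{p−m} (p/(m−p))^p (v(x)+1)^m. -/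
open MeasureTheory

/-- Chain rule for radial functions: the gradient of `g ∘ ‖·‖` at `x ≠ 0` has norm `|g' ‖x‖|`. -/
theorem norm_gradient_comp_norm {E : Type*} [NormedAddCommGroup E] [InnerProductSpace ℝ E]
    [CompleteSpace E] {g : ℝ → ℝ} {g' : ℝ} {x : E} (hx : x ≠ 0) (hg : HasDerivAt g g' ‖x‖) :
    DifferentiableAt ℝ (fun y => g ‖y‖) x ∧ ‖gradient (fun y => g ‖y‖) x‖ = |g'| := by
  have hnorm : DifferentiableAt ℝ (fun y : E => ‖y‖) x := differentiableAt_id.norm ℝ hx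
  have : Nontrivial E := ⟨x, 0, hx⟩
  have hcomp := hg.comp_hasFDerivAt x hnorm.hasFDerivAt
  refine ⟨hcomp.differentiableAt, ?_⟩
  rw [gradient, LinearIsometryEquiv.norm_map]
  have hfd : fderiv ℝ (fun y : E => g ‖y‖) x = g' • fderiv ℝ (fun y : E => ‖y‖) x := hcomp.fderiv
  rw [hfd, norm_smul, norm_fderiv_norm hnorm, mul_one, Real.norm_eq_abs]

/-- The barrier `v(x) = 2(1 + R - |x|)^{-p/(m-p)} - 1` satisfies the eikonal-type identity
`|∇v(x)|^p = 2^{p-m} (p/(m-p))^p (v(x)+1)^m` at every `x ≠ 0` in `B_R`. -/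
theorem barrier_gradient_identity
    (n : ℕ) (hn : 1 ≤ n) (p m R : ℝ) (hp : 1 < p) (hm : p < m) (hR : 0 < R)
    (v : EuclideanSpace ℝ (Fin n) → ℝ)
    (hv : ∀ x : EuclideanSpace ℝ (Fin n),
      v x = 2 * (1 + R - ‖x‖) ^ (-(p / (m - p))) - 1) :
    ∀ x ∈ Metric.ball (0 : EuclideanSpace ℝ (Fin n)) R, x ≠ 0 →
      DifferentiableAt ℝ v x ∧
        ‖gradient v x‖ ^ p =
          (2 : ℝ) ^ (p - m) * (p / (m - p)) ^ p * (v x + 1) ^ m := by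
  intro x hx hx0
  have hs : 0 < 1 + R - ‖x‖ := by linarith [mem_ball_zero_iff.mp hx]
  have hmp : 0 < m - p := sub_pos.mpr hm
  have ha : 0 < p / (m - p) := by positivity
  obtain rfl : v = fun y => 2 * (1 + R - ‖y‖) ^ (-(p / (m - p))) - 1 := funext hv
  have hexp : (-(p / (m - p)) - 1) * p = -(p / (m - p)) * m := by
    field_simp
    ring
  set a := p / (m - p)
  have hg : HasDerivAt (fun r : ℝ => 2 * (1 + R - r) ^ (-a) - 1)
      (2 * a * (1 + R - ‖x‖) ^ (-a - 1)) ‖x‖ := by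
    have h := ((((hasDerivAt_id ‖x‖).const_sub (1 + R)).rpow_const (p := -a)
      (Or.inl hs.ne')).const_mul 2).sub_const 1
    exact h.congr_deriv (by simp only [id]; ring)
  obtain ⟨hd, hgrad⟩ := norm_gradient_comp_norm hx0 hg
  refine ⟨hd, ?_⟩
  rw [hgrad, abs_of_pos (by positivity), sub_add_cancel, Real.mul_rpow (by positivity)
    (by positivity), Real.mul_rpow zero_le_two ha.le, Real.mul_rpow zero_le_two (by positivity),
    ← Real.rpow_mul hs.le, ← Real.rpow_mul hs.le, hexp, Real.rpow_sub two_pos]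
  have h2 : (0 : ℝ) < 2 ^ m := by positivity
  field_simp
end

section
/- Let p ∈ (1,∞), m > 0, ε ∈ (0,1], let Ω ⊂ ℝⁿ be a bounded open set, and let u : Ω → [−1,1] be Lipschitz. Define F : [−1,1] → ℝ by F(τ) = ∫_0^τ |1−σ²|^{m(p−1)/p} dσ. Then ∫_Ω |∇(F∘u)(x)| dx ≤ (1/ε) ∫_Ω ( ε^p |∇u(x)|^p + |1−u(x)²|^m ) dx. -/
open MeasureTheory intervalIntegral

theorem Real.mul_rpow_le_rpow_add_rpow {p m A W : ℝ} (hp : 1 < p) (hA : 0 ≤ A) (hW : 0 ≤ W) :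
    A * W ^ (m * (p - 1) / p) ≤ A ^ p + W ^ m := by
  have hp0 : 0 < p := by linarith
  have hpq : p.HolderConjugate (p / (p - 1)) := Real.HolderConjugate.conjExponent hp
  have young := Real.young_inequality_of_nonneg hA (Real.rpow_nonneg hW (m * (p - 1) / p)) hpq
  have hexp : m * (p - 1) / p * (p / (p - 1)) = m := by
    have : p - 1 ≠ 0 := by linarith
    field_simp
  rw [← Real.rpow_mul hW, hexp] at young
  have h₁ : A ^ p / p ≤ A ^ p := div_le_self (Real.rpow_nonneg hA p) hp.le
  have h₂ : W ^ m / (p / (p - 1)) ≤ W ^ m := div_le_self (Real.rpow_nonneg hW m) hpq.symm.lt.le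
  linarith

theorem norm_gradient_eq_norm_fderiv {E : Type*} [NormedAddCommGroup E] [InnerProductSpace ℝ E]
    [CompleteSpace E] (f : E → ℝ) (x : E) : ‖gradient f x‖ = ‖fderiv ℝ f x‖ := by
  simp [gradient]

/-- Total-variation bound for the rescaled phase function `F ∘ u`
(used for the BV compactness in Corollary 1.3):
`∫_Ω |∇(F∘u)| ≤ (1/ε) ∫_Ω (ε^p |∇u|^p + |1-u²|^m)`. -/
theorem phase_transformation_total_variation_bound
    (n : ℕ) (hn : 1 ≤ n) (p m ε : ℝ) (hp : 1 < p) (hm : 0 < m)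
    (hε : ε ∈ Set.Ioc (0 : ℝ) 1)
    (Ω : Set (EuclideanSpace ℝ (Fin n))) (hΩo : IsOpen Ω) (hΩb : Bornology.IsBounded Ω)
    (F : ℝ → ℝ)
    (hF : ∀ τ : ℝ, F τ = ∫ σ in (0 : ℝ)..τ, |1 - σ ^ 2| ^ (m * (p - 1) / p))
    (u : EuclideanSpace ℝ (Fin n) → ℝ)
    (hulip : ∃ K, LipschitzOnWith K u Ω)
    (hur : ∀ x ∈ Ω, u x ∈ Set.Icc (-1 : ℝ) 1) :
    (∫ x in Ω, ‖gradient (F ∘ u) x‖) ≤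
      (1 / ε) * ∫ x in Ω, (ε ^ p * ‖gradient u x‖ ^ p + |1 - u x ^ 2| ^ m) := by
  obtain ⟨K, hK⟩ := hulip
  have hε0 : 0 < ε := hε.1
  have hp0 : 0 < p := by linarith
  have hF' (τ : ℝ) : HasDerivAt F (|1 - τ ^ 2| ^ (m * (p - 1) / p)) τ := by
    have hs : 0 ≤ m * (p - 1) / p :=
      div_nonneg (mul_nonneg hm.le (by linarith)) hp0.le
    have hc : Continuous fun σ : ℝ => |1 - σ ^ 2| ^ (m * (p - 1) / p) :=
      Continuous.rpow_const (by fun_prop) fun _ => Or.inr hs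
    rw [funext hF]
    exact hc.integral_hasStrictDerivAt 0 τ |>.hasDerivAt
  simp_rw [norm_gradient_eq_norm_fderiv]
  rw [← MeasureTheory.integral_const_mul]
  have hint : IntegrableOn (fun x => ε ^ p * ‖fderiv ℝ u x‖ ^ p + |1 - u x ^ 2| ^ m) Ω := by
    have hu : AEMeasurable u (volume.restrict Ω) :=
      hK.continuousOn.aemeasurable hΩo.measurableSet
    have hmeas : AEMeasurable (fun x => ε ^ p * ‖fderiv ℝ u x‖ ^ p + |1 - u x ^ 2| ^ m)
        (volume.restrict Ω) :=
      ((((measurable_fderiv ℝ u).norm.pow_const p).const_mul _).aemeasurable).add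
        (((hu.pow_const 2).const_sub 1).norm.pow_const m)
    refine IntegrableOn.of_bound hΩb.measure_lt_top hmeas.aestronglyMeasurable
      (ε ^ p * (K : ℝ) ^ p + 1) ?_
    filter_upwards [ae_restrict_mem hΩo.measurableSet] with x hx
    have hfd : ‖fderiv ℝ u x‖ ≤ K := norm_fderiv_le_of_lipschitzOn ℝ (hΩo.mem_nhds hx) hK
    have hW : |1 - u x ^ 2| ≤ 1 := by
      have := hur x hx
      rw [abs_le]
      constructor <;> nlinarith [this.1, this.2]
    rw [Real.norm_of_nonneg (by positivity)]
    gcongr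
    exact Real.rpow_le_one (abs_nonneg _) hW hm.le
  refine integral_mono_of_nonneg (.of_forall fun x => norm_nonneg _) (hint.const_mul _) ?_
  filter_upwards [ae_restrict_mem hΩo.measurableSet,
    (ae_restrict_iff' hΩo.measurableSet).2 hK.ae_differentiableWithinAt_of_mem] with x hx hdx
  have hd : DifferentiableAt ℝ u x := hdx.differentiableAt (hΩo.mem_nhds hx)
  have hchain := ((hF' (u x)).comp_hasFDerivAt x hd.hasFDerivAt).fderiv
  have young := Real.mul_rpow_le_rpow_add_rpow (m := m) hp
    (mul_nonneg hε0.le (norm_nonneg (fderiv ℝ u x))) (abs_nonneg (1 - u x ^ 2))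
  rw [Real.mul_rpow hε0.le (norm_nonneg _)] at young
  simp only [hchain, norm_smul]
  rw [Real.norm_of_nonneg (by positivity), one_div, inv_mul_eq_div, le_div_iff₀ hε0]
  linarith
end
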